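/- arXiv:1903.06109 — 2 statements merged into one kernel-verified Lean document; each statement's English description precedes it below -/
import Mathlib

section
/- Consider the example system and the space-time process (Ŝ,ŵ⁰,ŵ,ŷ⁰,ŷ) with Ŝ = √2, (ŵ⁰,ŵ¹,ŵ²) = (√2/2,−√2/2,0) constant, ŷ⁰(s) = √2 s/2 and ŷ(s) = (1−√2 s/2, 0, 0, 0, √2 s/2). Suppose (p₀,p,λ) with p₀ ∈ ℝ, p = (p₁,…,p₅) : [0,√2] → ℝ⁵ absolutely continuous, λ ≥ 0, satisfies: the adjoint equation dp/ds = −p·(Df(ŷ)ŵ⁰ + Dg₁(ŷ)ŵ¹ + Dg₂(ŷ)ŵ²) a.e.; the non-transversality condition (p₀,p(√2)) ∈ −λDΨ(ŷ(√2)) − N, where N is the polar cone of the target {1}×𝔗 at (1,(0,0,0,0,1)); the maximization condition p₀ŵ⁰(s) + p(s)·(f(ŷ(s))ŵ⁰(s) + g₁(ŷ(s))ŵ¹(s) + g₂(ŷ(s))ŵ²(s)) = max_{(w⁰,w)∈𝒲} [p₀w⁰ + p(s)·(f(ŷ(s))w⁰ + g₁(ŷ(s))w¹ + g₂(ŷ(s))w²)]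 for a.e. s; the vanishing conditions max_{(w⁰,w)∈𝒲}[p₀w⁰ + p(s)·(f(ŷ(s))w⁰ + Σᵢ gᵢ(ŷ(s))wⁱ)] = 0 and p(s)·gᵢ(ŷ(s)) = 0 for all s ∈ [0,√2], i = 1,2. Then p is constant and p₀ = 0, p₁ = p₂ = p₅ = 0, p₃ = p₄ = −λ; consequently, if (p₀,p,λ) ≠ (0,0,0) then λ > 0. -/
open MeasureTheory Set
open scoped RealInnerProductSpace

noncomputable section

/-- `ℝⁿ` with the Euclidean norm. -/
abbrev E (n : ℕ) : Type := EuclideanSpace ℝ (Fin n)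

/-- The vector `(a,b,c,d,e) ∈ ℝ⁵`. -/
def vec5 (a b c d e : ℝ) : E 5 := (WithLp.equiv 2 (Fin 5 → ℝ)).symm ![a, b, c, d, e]

/-- The vector `(a,b) ∈ ℝ²`. -/
def vec2 (a b : ℝ) : E 2 := (WithLp.equiv 2 (Fin 2 → ℝ)).symm ![a, b]

/-- The drift `f(x) = ½((x²)² + (x³)² + (1−x¹−x⁵)²) e₄ + e₅` of the example. -/
def fEx (x : E 5) : E 5 :=
  vec5 0 0 0 (((x 1) ^ 2 + (x 2) ^ 2 + (1 - x 0 - x 4) ^ 2) / 2) 1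

/-- The control vector field `g₁(x) = e₁ − ½(x²)² e₃` of the example. -/
def g1Ex (x : E 5) : E 5 := vec5 1 0 (-(x 1) ^ 2 / 2) 0 0

/-- The control vector field `g₂(x) = e₂` of the example. -/
def g2Ex (_ : E 5) : E 5 := vec5 0 1 0 0 0

/-- The pair of control vector fields of the example. -/
def gEx : Fin 2 → E 5 → E 5 := ![g1Ex, g2Ex]

/-- The initial point `x̌ = (1,0,0,0,0)` of the example. -/
def xInit : E 5 := vec5 1 0 0 0 0

/-- The target `𝔗 = {x ∈ ℝ⁵ : x¹ = x² = 0, x³ ≥ −1}` of the example. -/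
def TT : Set (E 5) := {x | x 0 = 0 ∧ x 1 = 0 ∧ -1 ≤ x 2}

/-- A space-time process of the extended system of the example:
`dy⁰/ds = w⁰`, `dy/ds = f(y)w⁰ + g₁(y)w¹ + g₂(y)w²`, `(y⁰,y)(0) = (0,x̌)`, with
`(w⁰,w) ∈ L^∞([0,S],𝒲)`, `𝒲 = {w⁰ ≥ 0, w⁰ + |w| = 1}`. -/
def IsSpaceTimeProcessEx (S : ℝ) (w0 : ℝ → ℝ) (w : ℝ → E 2) (y0 : ℝ → ℝ) (y : ℝ → E 5) :
    Prop :=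
  0 < S ∧ AEMeasurable w0 (volume.restrict (Icc 0 S)) ∧
  AEMeasurable w (volume.restrict (Icc 0 S)) ∧
  (∀ s ∈ Icc (0:ℝ) S, 0 ≤ w0 s ∧ w0 s + ‖w s‖ = 1) ∧
  ContinuousOn y (Icc 0 S) ∧
  IntegrableOn (fun σ => w0 σ • fEx (y σ) + ∑ i, w σ i • gEx i (y σ)) (Icc 0 S) ∧
  (∀ s ∈ Icc (0:ℝ) S, y0 s = ∫ σ in (0:ℝ)..s, w0 σ) ∧
  (∀ s ∈ Icc (0:ℝ) S, y s = xInit + ∫ σ in (0:ℝ)..s,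
    (w0 σ • fEx (y σ) + ∑ i, w σ i • gEx i (y σ)))

/-- The unmaximized Hamiltonian of the example:
`H(x,p₀,p,w⁰,w) = p₀w⁰ + p·(f(x)w⁰ + g₁(x)w¹ + g₂(x)w²)`. -/
def HamEx (x : E 5) (p0 : ℝ) (p : E 5) (w0 : ℝ) (w : E 2) : ℝ :=
  p0 * w0 + ⟪p, w0 • fEx x + ∑ i, w i • gEx i x⟫

/-- The maximized Hamiltonian of the example: `𝐇(x,p₀,p) = max_{(w⁰,w)∈𝒲} H`. -/
def maxHamEx (x : E 5) (p0 : ℝ) (p : E 5) : ℝ :=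
  sSup {h : ℝ | ∃ (w0 : ℝ) (w : E 2), 0 ≤ w0 ∧ w0 + ‖w‖ = 1 ∧ h = HamEx x p0 p w0 w}

/-- A square of a differentiable function has zero derivative at a zero of that function. -/
theorem hasFDerivAt_sq_of_eq_zero {F : Type*} [NormedAddCommGroup F] [NormedSpace ℝ F]
    {h : F → ℝ} {x : F} (hd : DifferentiableAt ℝ h x) (hx : h x = 0) :
    HasFDerivAt (fun y => h y ^ 2) (0 : F →L[ℝ] ℝ) x := by
  simpa [hx] using hd.hasFDerivAt.pow 2

theorem fderiv_fEx_eq_zero {x : E 5} (h1 : x 1 = 0) (h2 : x 2 = 0) (h3 : 1 - x 0 - x 4 = 0) :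
    fderiv ℝ fEx x = 0 := by
  apply HasFDerivAt.fderiv
  rw [← hasFDerivWithinAt_univ, hasFDerivWithinAt_euclidean]
  intro i
  rw [ContinuousLinearMap.comp_zero, hasFDerivWithinAt_univ]
  fin_cases i
  · exact hasFDerivAt_const (0 : ℝ) x
  · exact hasFDerivAt_const (0 : ℝ) x
  · exact hasFDerivAt_const (0 : ℝ) x
  · have hs := ((hasFDerivAt_sq_of_eq_zero (h := fun y : E 5 => y 1) (by fun_prop) h1).add
      (hasFDerivAt_sq_of_eq_zero (h := fun y : E 5 => y 2) (by fun_prop) h2)).add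
      (hasFDerivAt_sq_of_eq_zero (h := fun y : E 5 => 1 - y 0 - y 4) (by fun_prop) h3)
    simpa [fEx, vec5, div_eq_mul_inv] using hs.mul_const (2⁻¹ : ℝ)
  · exact hasFDerivAt_const (1 : ℝ) x

theorem fderiv_gEx_eq_zero {x : E 5} (h1 : x 1 = 0) (i : Fin 2) : fderiv ℝ (gEx i) x = 0 := by
  fin_cases i
  · apply HasFDerivAt.fderiv
    rw [← hasFDerivWithinAt_univ, hasFDerivWithinAt_euclidean]
    intro j
    rw [ContinuousLinearMap.comp_zero, hasFDerivWithinAt_univ]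
    fin_cases j
    · exact hasFDerivAt_const (1 : ℝ) x
    · exact hasFDerivAt_const (0 : ℝ) x
    · have hs := (hasFDerivAt_sq_of_eq_zero (h := fun y : E 5 => y 1) (by fun_prop) h1).neg
      simpa [gEx, g1Ex, vec5, div_eq_mul_inv] using hs.mul_const (2⁻¹ : ℝ)
    · exact hasFDerivAt_const (0 : ℝ) x
    · exact hasFDerivAt_const (0 : ℝ) x
  · exact (hasFDerivAt_const (vec5 0 1 0 0 0) x).fderiv

/-- any multiplier `(p₀,p,λ)` satisfying the adjoint equation, the
non-transversality condition, the maximization condition and the vanishing conditions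
along the extremal `(Ŝ,ŵ⁰,ŵ,ŷ⁰,ŷ)` (with `Ŝ = √2`) is constant, with
`p₀ = p₁ = p₂ = p₅ = 0` and `p₃ = p₄ = −λ`; hence a non-zero such multiplier has
`λ > 0`. -/
theorem stmt12
    (hatS : ℝ) (hS : hatS = Real.sqrt 2)
    (hatw0 : ℝ → ℝ) (hw0 : ∀ s, hatw0 s = Real.sqrt 2 / 2)
    (hatw : ℝ → E 2) (hw : ∀ s, hatw s = vec2 (-(Real.sqrt 2 / 2)) 0)
    (haty0 : ℝ → ℝ) (hy0 : ∀ s, haty0 s = Real.sqrt 2 * s / 2)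
    (haty : ℝ → E 5)
    (hy : ∀ s, haty s = vec5 (1 - Real.sqrt 2 * s / 2) 0 0 0 (Real.sqrt 2 * s / 2))
    (p0 lam : ℝ) (p : ℝ → E 5)
    (hlam : 0 ≤ lam)
    (hpc : ContinuousOn p (Icc 0 hatS))
    -- adjoint equation (in integral form, encoding absolute continuity)
    (hadj : ∀ s ∈ Icc (0:ℝ) hatS, p s = p 0 - ∫ σ in (0:ℝ)..s,
      (hatw0 σ • (ContinuousLinearMap.adjoint (fderiv ℝ fEx (haty σ))) (p σ) +
       ∑ i, hatw σ i • (ContinuousLinearMap.adjoint (fderiv ℝ (gEx i) (haty σ))) (p σ)))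
    -- non-transversality: `(p₀,p(√2)) ∈ −λDΨ(ŷ(√2)) − N`, where `DΨ = (0,(0,0,1,1,0))`
    -- and `N` is the polar cone of `{1}×𝔗` at `(1,(0,0,0,0,1))`
    (htrans : ∃ a c₀ c₁ c₂ : ℝ, 0 ≤ a ∧
      (-(haty hatS 2) - 1 ≠ 0 → a = 0) ∧
      ((p0, p hatS) : ℝ × E 5) =
        -(lam • (((0:ℝ), vec5 0 0 1 1 0) : ℝ × E 5)) -
        (a • (((0:ℝ), vec5 0 0 (-1) 0 0) : ℝ × E 5) +
         c₀ • (((1:ℝ), (0 : E 5)) : ℝ × E 5) +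
         c₁ • (((0:ℝ), vec5 1 0 0 0 0) : ℝ × E 5) +
         c₂ • (((0:ℝ), vec5 0 1 0 0 0) : ℝ × E 5)))
    -- first-order maximization
    (hmax : ∀ᵐ s ∂(volume.restrict (Icc (0:ℝ) hatS)),
      HamEx (haty s) p0 (p s) (hatw0 s) (hatw s) = maxHamEx (haty s) p0 (p s))
    -- vanishing of the Hamiltonians
    (hvan : ∀ s ∈ Icc (0:ℝ) hatS, maxHamEx (haty s) p0 (p s) = 0)
    (hvg : ∀ s ∈ Icc (0:ℝ) hatS, ∀ i, ⟪p s, gEx i (haty s)⟫ = 0) :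
    (∀ s ∈ Icc (0:ℝ) hatS, p s = p 0) ∧
    p0 = 0 ∧
    (∀ s ∈ Icc (0:ℝ) hatS,
      p s 0 = 0 ∧ p s 1 = 0 ∧ p s 4 = 0 ∧ p s 2 = -lam ∧ p s 3 = -lam) ∧
    (¬ (p0 = 0 ∧ (∀ s ∈ Icc (0:ℝ) hatS, p s = 0) ∧ lam = 0) → 0 < lam) := by
  have hSpos : 0 < hatS := by rw [hS]; positivity
  have hy1 : ∀ s, haty s 1 = 0 := fun s => by simp [hy, vec5]
  have hy2 : ∀ s, haty s 2 = 0 := fun s => by simp [hy, vec5]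
  have hy3 : ∀ s, 1 - haty s 0 - haty s 4 = 0 := fun s => by simp [hy, vec5]
  have hconst : ∀ s ∈ Icc (0:ℝ) hatS, p s = p 0 := by
    intro s hs
    rw [hadj s hs]
    simp [fderiv_fEx_eq_zero (hy1 _) (hy2 _) (hy3 _), fderiv_gEx_eq_zero (hy1 _)]
  have hend : hatS ∈ Icc (0:ℝ) hatS := right_mem_Icc.2 hSpos.le
  obtain ⟨a, c₀, c₁, c₂, -, hcompl, heq⟩ := htrans
  obtain rfl : a = 0 := hcompl (by simp [hy2])
  have hpS : p hatS = -(lam • vec5 0 0 1 1 0) -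
      (c₁ • vec5 1 0 0 0 0 + c₂ • vec5 0 1 0 0 0) := by
    simpa using congrArg Prod.snd heq
  have hp : ∀ s ∈ Icc (0:ℝ) hatS,
      p s 0 = 0 ∧ p s 1 = 0 ∧ p s 4 = 0 ∧ p s 2 = -lam ∧ p s 3 = -lam := by
    intro s hs
    have hsS : p s = p hatS := (hconst s hs).trans (hconst hatS hend).symm
    refine ⟨?_, ?_, ?_, ?_, ?_⟩
    · simpa [gEx, g1Ex, vec5, hy1, PiLp.inner_apply, Fin.sum_univ_succ] using hvg s hs 0
    · simpa [gEx, g2Ex, vec5, PiLp.inner_apply, Fin.sum_univ_succ] using hvg s hs 1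
    all_goals simp [hsS, hpS, vec5]
  have hp0 : p0 = 0 := by
    have hne : (volume.restrict (Icc (0:ℝ) hatS)) ≠ 0 := by
      simp [Measure.restrict_eq_zero, hSpos]
    have : (ae (volume.restrict (Icc (0:ℝ) hatS))).NeBot := ae_neBot.2 hne
    obtain ⟨s, hH, hs⟩ := (hmax.and (ae_restrict_mem measurableSet_Icc)).exists
    rw [hvan s hs, HamEx, inner_add_right, inner_smul_right, inner_sum] at hH
    have hf : ⟪p s, fEx (haty s)⟫ = 0 := by
      have h4 := (hp s hs).2.2.1
      have hq : fEx (haty s) = vec5 0 0 0 0 1 := by simp [fEx, hy1, hy2, hy3]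
      rw [hq]
      simpa [vec5, PiLp.inner_apply, Fin.sum_univ_succ] using h4
    simpa [hf, inner_smul_right, hvg s hs, hw0] using hH
  refine ⟨hconst, hp0, hp, fun hne => hlam.lt_of_ne' ?_⟩
  rintro rfl
  refine hne ⟨hp0, fun s hs => ?_, rfl⟩
  obtain ⟨h0, h1, h4, h2, h3⟩ := hp s hs
  ext i
  fin_cases i <;> simp [h0, h1, h2, h3, h4]
end
end

section
/- In the example system, the constant multiplier (p₀,p,λ) := (0,(0,0,0,−1,0),1) satisfies, along the space-time process (S̄,w̄⁰,w̄,ȳ⁰,ȳ) defined by S̄ := √2 + 4·2^{1/3} with the five-piece control and trajectory of the example, all of the following: (i) (p₀,p,λ) ≠ (0,0,0), and indeed (p,λ) ≠ (0,0); (ii) (p₀,p(S̄)) ∈ −λDΨ(ȳ(S̄)) − N, where N is the polar cone of {1}×𝔗 at (1,(0,0,−1,0,1)); (iii) the constant p solves the adjoint equation dp/ds = −p·(Df(ȳ)w̄⁰ + Dg₁(ȳ)w̄¹ + Dg₂(ȳ)w̄²) a.e. on [0,S̄]; (iv) for a.e. s, p₀w̄⁰(s) + p·(f(ȳ(s))w̄⁰(s)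 + Σᵢ gᵢ(ȳ(s))w̄ⁱ(s)) = max_{(w⁰,w)∈𝒲}[p₀w⁰ + p·(f(ȳ(s))w⁰ + Σᵢ gᵢ(ȳ(s))wⁱ)]; (v) this maximum equals 0 for all s ∈ [0,S̄], and p·gᵢ(ȳ(s)) = 0 for all s and i = 1,2; (vi) p·B(ȳ(s)) = 0 for all s ∈ [0,S̄] and every iterated Lie bracket B of g₁,g₂. -/
open MeasureTheory Set
open scoped RealInnerProductSpace

noncomputable section

/-- The Lie bracket `[F₁,F₂](x) := DF₂(x)F₁(x) − DF₁(x)F₂(x)`. -/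
def lieB (F₁ F₂ : E 5 → E 5) : E 5 → E 5 :=
  fun x => fderiv ℝ F₂ x (F₁ x) - fderiv ℝ F₁ x (F₂ x)

/-- The iterated Lie brackets of `g₁,g₂`. -/
inductive IsIterBracket : (E 5 → E 5) → Prop
  | base (i : Fin 2) : IsIterBracket (gEx i)
  | br {B₁ B₂ : E 5 → E 5} : IsIterBracket B₁ → IsIterBracket B₂ →
      IsIterBracket (lieB B₁ B₂)

/-- `2^{1/3}`. -/
def cRt : ℝ := (2 : ℝ) ^ ((1 : ℝ) / 3)

/-- If `x ↦ ⟪p, F x⟫` has a local maximum at `x`, then `DF(x)ᵀ p = 0`. This also holds when `F` is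
not differentiable at `x`, as then `fderiv ℝ F x = 0`. -/
lemma adjoint_fderiv_eq_zero_of_isLocalMax {n : ℕ} {F : E n → E n} {p x : E n}
    (h : IsLocalMax (fun z => ⟪p, F z⟫) x) :
    ContinuousLinearMap.adjoint (fderiv ℝ F x) p = 0 := by
  by_cases hF : DifferentiableAt ℝ F x
  · refine ext_inner_right ℝ fun v => ?_
    rw [ContinuousLinearMap.adjoint_inner_left, inner_zero_left]
    have hd : HasFDerivAt (fun z => ⟪p, F z⟫) ((innerSL ℝ p).comp (fderiv ℝ F x)) x :=
      (innerSL ℝ p).hasFDerivAt.comp x hF.hasFDerivAt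
    simpa using DFunLike.congr_fun (h.hasFDerivAt_eq_zero hd) v
  · rw [fderiv_zero_of_not_differentiableAt hF]
    simp

lemma adjoint_fderiv_eq_zero_of_inner_eq_zero {n : ℕ} {F : E n → E n} {p : E n}
    (h : ∀ z, ⟪p, F z⟫ = 0) (x : E n) :
    ContinuousLinearMap.adjoint (fderiv ℝ F x) p = 0 :=
  adjoint_fderiv_eq_zero_of_isLocalMax (Filter.Eventually.of_forall fun z => by simp [h])

lemma inner_lieB_eq_zero {F₁ F₂ : E 5 → E 5} {p : E 5}
    (h₁ : ∀ z, ⟪p, F₁ z⟫ = 0) (h₂ : ∀ z, ⟪p, F₂ z⟫ = 0) (x : E 5) :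
    ⟪p, lieB F₁ F₂ x⟫ = 0 := by
  rw [lieB, inner_sub_right, ← ContinuousLinearMap.adjoint_inner_left,
    ← ContinuousLinearMap.adjoint_inner_left, adjoint_fderiv_eq_zero_of_inner_eq_zero h₁,
    adjoint_fderiv_eq_zero_of_inner_eq_zero h₂]
  simp

lemma IsIterBracket.inner_eq_zero {p : E 5} (hg : ∀ i z, ⟪p, gEx i z⟫ = 0) {B : E 5 → E 5}
    (hB : IsIterBracket B) (x : E 5) : ⟪p, B x⟫ = 0 := by
  induction hB generalizing x with
  | base i => exact hg i x
  | br _ _ h₁ h₂ => exact inner_lieB_eq_zero h₁ h₂ x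

lemma HamEx_eq_mul {p : E 5} (hg : ∀ i z, ⟪p, gEx i z⟫ = 0) (x : E 5) (w0 : ℝ) (w : E 2) :
    HamEx x 0 p w0 w = w0 * ⟪p, fEx x⟫ := by
  simp [HamEx, inner_add_right, inner_smul_right, hg]

lemma maxHamEx_eq_zero {p : E 5} (hg : ∀ i z, ⟪p, gEx i z⟫ = 0) {x : E 5}
    (hf : ⟪p, fEx x⟫ ≤ 0) : maxHamEx x 0 p = 0 := by
  refine IsGreatest.csSup_eq ⟨⟨0, EuclideanSpace.single 0 1, le_rfl, by simp, ?_⟩, ?_⟩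
  · simp [HamEx_eq_mul hg]
  · rintro _ ⟨w0, w, hw0, -, rfl⟩
    rw [HamEx_eq_mul hg]
    exact mul_nonpos_of_nonneg_of_nonpos hw0 hf

lemma inner_vec5_gEx (i : Fin 2) (x : E 5) : ⟪vec5 0 0 0 (-1) 0, gEx i x⟫ = 0 := by
  fin_cases i <;> simp [gEx, g1Ex, g2Ex, vec5, PiLp.inner_apply, Fin.sum_univ_five]

lemma inner_vec5_fEx (x : E 5) :
    ⟪vec5 0 0 0 (-1) 0, fEx x⟫ = -(((x 1) ^ 2 + (x 2) ^ 2 + (1 - x 0 - x 4) ^ 2) / 2) := by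
  simp [fEx, vec5, PiLp.inner_apply, Fin.sum_univ_five]

lemma inner_vec5_fEx_nonpos (x : E 5) : ⟪vec5 0 0 0 (-1) 0, fEx x⟫ ≤ 0 := by
  rw [inner_vec5_fEx]
  exact neg_nonpos.2 (by positivity)

lemma cRt_pos : 0 < cRt := Real.rpow_pos_of_pos two_pos _

/-- the constant multiplier `(p₀,p,λ) = (0,(0,0,0,−1,0),1)` satisfies all
the conditions (i)–(vi) of the Higher Order Maximum Principle along the five-piece
space-time process `(S̄,w̄⁰,w̄,ȳ⁰,ȳ)` of the example, with `S̄ = √2 + 4·2^{1/3}`. -/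
theorem stmt15
    (Sb : ℝ) (hSb : Sb = Real.sqrt 2 + 4 * cRt)
    (wb0 : ℝ → ℝ)
    (hwb0 : ∀ s, wb0 s = if s ≤ Real.sqrt 2 then Real.sqrt 2 / 2 else 0)
    (wb : ℝ → E 2)
    (hwb : ∀ s, wb s =
      if s ≤ Real.sqrt 2 then vec2 (-(Real.sqrt 2 / 2)) 0
      else if s ≤ Real.sqrt 2 + cRt then vec2 (-1) 0
      else if s ≤ Real.sqrt 2 + 2 * cRt then vec2 0 (-1)
      else if s ≤ Real.sqrt 2 + 3 * cRt then vec2 1 0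
      else vec2 0 1)
    (yb0 : ℝ → ℝ)
    (hyb0 : ∀ s, yb0 s = if s ≤ Real.sqrt 2 then Real.sqrt 2 * s / 2 else 1)
    (yb : ℝ → E 5)
    (hyb : ∀ s, yb s =
      if s ≤ Real.sqrt 2 then
        vec5 (1 - Real.sqrt 2 * s / 2) 0 0 0 (Real.sqrt 2 * s / 2)
      else if s ≤ Real.sqrt 2 + cRt then
        vec5 (Real.sqrt 2 - s) 0 0 0 1
      else if s ≤ Real.sqrt 2 + 2 * cRt then
        vec5 (-cRt) (Real.sqrt 2 + cRt - s) 0 0 1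
      else if s ≤ Real.sqrt 2 + 3 * cRt then
        vec5 (s - Real.sqrt 2 - 3 * cRt) (-cRt)
          (cRt ^ 2 * (Real.sqrt 2 + 2 * cRt - s) / 2) 0 1
      else
        vec5 0 (s - Real.sqrt 2 - 4 * cRt) (-1) 0 1)
    (p0 lam : ℝ) (pB : E 5)
    (hp0 : p0 = 0) (hlam : lam = 1) (hpB : pB = vec5 0 0 0 (-1) 0) :
    -- (i) non-triviality, in its strengthened form
    ((p0, pB, lam) : ℝ × E 5 × ℝ) ≠ (0, 0, 0) ∧ ((pB, lam) : E 5 × ℝ) ≠ (0, 0) ∧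
    -- (ii) non-transversality at `(1,(0,0,−1,0,1))`
    (∃ a c₀ c₁ c₂ : ℝ, 0 ≤ a ∧
      (-(yb Sb 2) - 1 ≠ 0 → a = 0) ∧
      ((p0, pB) : ℝ × E 5) =
        -(lam • (((0:ℝ), vec5 0 0 1 1 0) : ℝ × E 5)) -
        (a • (((0:ℝ), vec5 0 0 (-1) 0 0) : ℝ × E 5) +
         c₀ • (((1:ℝ), (0 : E 5)) : ℝ × E 5) +
         c₁ • (((0:ℝ), vec5 1 0 0 0 0) : ℝ × E 5) +
         c₂ • (((0:ℝ), vec5 0 1 0 0 0) : ℝ × E 5))) ∧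
    -- (iii) the constant `p ≡ pB` solves the adjoint equation a.e.
    (∀ᵐ s ∂(volume.restrict (Icc (0:ℝ) Sb)),
      wb0 s • (ContinuousLinearMap.adjoint (fderiv ℝ fEx (yb s))) pB +
        ∑ i, wb s i • (ContinuousLinearMap.adjoint (fderiv ℝ (gEx i) (yb s))) pB = 0) ∧
    -- (iv) first-order maximization
    (∀ᵐ s ∂(volume.restrict (Icc (0:ℝ) Sb)),
      HamEx (yb s) p0 pB (wb0 s) (wb s) = maxHamEx (yb s) p0 pB) ∧
    -- (v) vanishing of the Hamiltonians
    (∀ s ∈ Icc (0:ℝ) Sb, maxHamEx (yb s) p0 pB = 0) ∧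
    (∀ s ∈ Icc (0:ℝ) Sb, ∀ i, ⟪pB, gEx i (yb s)⟫ = 0) ∧
    -- (vi) vanishing of the higher order Hamiltonians
    (∀ B : E 5 → E 5, IsIterBracket B → ∀ s ∈ Icc (0:ℝ) Sb, ⟪pB, B (yb s)⟫ = 0) := by
  subst hp0 hlam hpB
  have hf : ∀ s, s ≤ Real.sqrt 2 → ⟪vec5 0 0 0 (-1) 0, fEx (yb s)⟫ = 0 := fun s hs => by
    rw [inner_vec5_fEx, hyb, if_pos hs]
    simp [vec5]
  have hmax : ∀ s, maxHamEx (yb s) 0 (vec5 0 0 0 (-1) 0) = 0 := fun s =>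
    maxHamEx_eq_zero inner_vec5_gEx (inner_vec5_fEx_nonpos _)
  refine ⟨by simp, by simp, ⟨1, 0, 0, 0, zero_le_one, ?_, ?_⟩, .of_forall fun s => ?_,
    .of_forall fun s => ?_, fun s _ => hmax s, fun s _ i => inner_vec5_gEx i _,
    fun B hB s _ => hB.inner_eq_zero inner_vec5_gEx _⟩
  · have hc := cRt_pos
    rw [hyb, if_neg (by linarith), if_neg (by linarith), if_neg (by linarith),
      if_neg (by linarith)]
    simp [vec5]
  · refine Prod.ext (by simp) (PiLp.ext fun i => ?_)
    fin_cases i <;> simp [vec5]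
  · have hg := fun i => adjoint_fderiv_eq_zero_of_inner_eq_zero (inner_vec5_gEx i) (yb s)
    rw [hwb0]
    split_ifs with hs
    · rw [adjoint_fderiv_eq_zero_of_isLocalMax (F := fEx)
        (.of_forall fun z => (inner_vec5_fEx_nonpos z).trans_eq (hf s hs).symm)]
      simp [hg]
    · simp [hg]
  · rw [hmax, HamEx_eq_mul inner_vec5_gEx, hwb0]
    split_ifs with hs
    · rw [hf s hs, mul_zero]
    · rw [zero_mul]
end
end
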